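/- arXiv:2206.00548 — 4 statements merged into one kernel-verified Lean document; each statement's English description precedes it below -/
import Mathlib

section
/- Let P be a standard parabolic submonoid of a Garside monoid M. Then P has a Garside element Δ_P given by Δ_P = H_P(Δ), the left P-head of Δ: that is, the left-divisors of Δ_P and the right-divisors of Δ_P coincide, they all lie in P, and they generate P. Moreover Δ_P is also the maximal right-divisor of Δ lying in P. -/
/-!
Common setting: Garside monoids, standard parabolic submonoids, heads,
ribbons, following Digne–Michel, "Ribbons in Garside monoids".
-/

namespace GarsidePaper

variable {M : Type*}

/-- `a` left-divides `b` : `b = a * c` for some `c`. -/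
def LDvd [Monoid M] (a b : M) : Prop := ∃ c, b = a * c

/-- `a` right-divides `b` : `b = c * a` for some `c`. -/
def RDvd [Monoid M] (a b : M) : Prop := ∃ c, b = c * a

/-- `a` is a factor of `b` : `a` left-divides a right-divisor of `b`. -/
def IsFactor [Monoid M] (a b : M) : Prop := ∃ c, LDvd a c ∧ RDvd c b

/-- A Garside structure on a (left- and right-) cancellative monoid `M`:
left/right gcds and lcms, Noetherianity, and a Garside element `Δ`. -/
structure GarsideStruct (M : Type*) [CancelMonoid M] where
  /-- left-gcd : gcd for the left-divisibility order -/
  lgcd : M → M → M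
  lgcd_dvd_left : ∀ a b, LDvd (lgcd a b) a
  lgcd_dvd_right : ∀ a b, LDvd (lgcd a b) b
  lgcd_greatest : ∀ a b d, LDvd d a → LDvd d b → LDvd d (lgcd a b)
  /-- right-lcm : lcm for the left-divisibility order -/
  rlcm : M → M → M
  ldvd_rlcm_left : ∀ a b, LDvd a (rlcm a b)
  ldvd_rlcm_right : ∀ a b, LDvd b (rlcm a b)
  rlcm_least : ∀ a b m, LDvd a m → LDvd b m → LDvd (rlcm a b) m
  /-- right-gcd : gcd for the right-divisibility order -/
  rgcd : M → M → M
  rgcd_dvd_left : ∀ a b, RDvd (rgcd a b) a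
  rgcd_dvd_right : ∀ a b, RDvd (rgcd a b) b
  rgcd_greatest : ∀ a b d, RDvd d a → RDvd d b → RDvd d (rgcd a b)
  /-- left-lcm : lcm for the right-divisibility order -/
  llcm : M → M → M
  rdvd_llcm_left : ∀ a b, RDvd a (llcm a b)
  rdvd_llcm_right : ∀ a b, RDvd b (llcm a b)
  llcm_least : ∀ a b m, RDvd a m → RDvd b m → RDvd (llcm a b) m
  /-- Noetherian: no infinite sequence where each term is a proper factor
  of the previous one. -/
  noetherian : WellFounded (fun a b : M => IsFactor a b ∧ a ≠ b)
  /-- the Garside element -/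
  Δ : M
  /-- the left- and right-divisors of `Δ` coincide -/
  delta_balanced : ∀ a : M, LDvd a Δ ↔ RDvd a Δ
  /-- the divisors of `Δ` generate `M` -/
  delta_generates : Submonoid.closure {a : M | LDvd a Δ} = ⊤

variable [CancelMonoid M]

/-- An atom: an element with no proper nontrivial divisor (factor). -/
def IsAtom' (a : M) : Prop := a ≠ 1 ∧ ∀ b : M, IsFactor b a → b = 1 ∨ b = a

/-- A standard parabolic submonoid: a submonoid closed under factors in which
every element of `M` has a maximal left-divisor (the left `P`-head) and a
maximal right-divisor (the right `P`-head) lying in `P`. -/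
structure IsStdParabolic (P : Submonoid M) : Prop where
  factor_closed : ∀ a b : M, b ∈ P → IsFactor a b → a ∈ P
  exists_left_head : ∀ g : M, ∃ h, h ∈ P ∧ LDvd h g ∧
    ∀ h', h' ∈ P → LDvd h' g → LDvd h' h
  exists_right_head : ∀ g : M, ∃ h, h ∈ P ∧ RDvd h g ∧
    ∀ h', h' ∈ P → RDvd h' g → RDvd h' h

/-- `h` is the left `P`-head `H_P g` of `g` : the maximal left-divisor of `g`
lying in `P`. -/
def IsLeftHead (P : Set M) (g h : M) : Prop :=
  h ∈ P ∧ LDvd h g ∧ ∀ h', h' ∈ P → LDvd h' g → LDvd h' h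

/-- `h` is the right `P`-head of `g` : the maximal right-divisor of `g`
lying in `P`. -/
def IsRightHead (P : Set M) (g h : M) : Prop :=
  h ∈ P ∧ RDvd h g ∧ ∀ h', h' ∈ P → RDvd h' g → RDvd h' h

/-- `g` is `P`-reduced : `H_P g = 1`, i.e. the only left-divisor of `g`
lying in `P` is `1`. -/
def PReduced (P : Set M) (g : M) : Prop := ∀ h ∈ P, LDvd h g → h = 1

/-- `P ^ g` is defined: `p ^ g` is defined (`g ≼ p * g`) for every `p ∈ P`. -/
def ConjSetDef (P : Set M) (g : M) : Prop := ∀ p ∈ P, LDvd g (p * g)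

/-- The set `P ^ g = { p ^ g : p ∈ P }`, where `p ^ g` is the unique `c`
with `p * g = g * c`. -/
def conjSet (P : Set M) (g : M) : Set M := {c : M | ∃ p ∈ P, p * g = g * c}

/-- A `P`-ribbon: a `P`-reduced element `g` such that `P ^ g` is defined. -/
def IsRibbon (P : Set M) (g : M) : Prop := PReduced P g ∧ ConjSetDef P g

/-- `P` is the smallest standard parabolic submonoid containing `S₁`. -/
def IsSmallestParabolicContaining (S₁ : Set M) (P : Submonoid M) : Prop :=
  IsStdParabolic P ∧ S₁ ⊆ (P : Set M) ∧
    ∀ Q : Submonoid M, IsStdParabolic Q → S₁ ⊆ (Q : Set M) → P ≤ Q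

/-- Assumption 1: for any set `S₁` of atoms, the right-lcm of `S₁` is the
Garside element `Δ_{P₁} = H_{P₁}(Δ)` of the smallest standard parabolic
submonoid `P₁` containing `S₁`. -/
def Assumption1 (G : GarsideStruct M) : Prop :=
  ∀ S₁ : Set M, (∀ s ∈ S₁, IsAtom' s) →
    ∀ P₁ : Submonoid M, IsSmallestParabolicContaining S₁ P₁ →
      ∀ d : M, IsLeftHead (P₁ : Set M) G.Δ d →
        (∀ s ∈ S₁, LDvd s d) ∧ ∀ m : M, (∀ s ∈ S₁, LDvd s m) → LDvd d m

/-- Assumption 2: some (positive) power of `Δ` is central. -/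
def Assumption2 (G : GarsideStruct M) : Prop :=
  ∃ n : ℕ, 0 < n ∧ ∀ x : M, G.Δ ^ n * x = x * G.Δ ^ n

/-- `v = v_{s,P}` : the element defined by `Δ_{P_s} = Δ_P * v`, where `P_s`
is the smallest standard parabolic submonoid containing `P` and `s`. -/
def IsVsp (G : GarsideStruct M) (P : Submonoid M) (s v : M) : Prop :=
  ∃ Ps : Submonoid M, IsSmallestParabolicContaining ((P : Set M) ∪ {s}) Ps ∧
    ∃ dP dPs : M, IsLeftHead (P : Set M) G.Δ dP ∧
      IsLeftHead (Ps : Set M) G.Δ dPs ∧ dPs = dP * v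

theorem LDvd.isFactor {a b : M} (h : LDvd a b) : IsFactor a b :=
  ⟨b, h, 1, (one_mul b).symm⟩

theorem RDvd.isFactor {a b : M} (h : RDvd a b) : IsFactor a b :=
  ⟨a, ⟨1, (mul_one a).symm⟩, h⟩

/-- In a Noetherian monoid the factor relation is antisymmetric. -/
theorem GarsideStruct.eq_of_isFactor (G : GarsideStruct M) {a b : M}
    (hab : IsFactor a b) (hba : IsFactor b a) : a = b := by
  by_contra hne
  exact G.noetherian.asymmetric a b ⟨hab, hne⟩ ⟨hba, Ne.symm hne⟩

/-- The left and right heads of the Garside element in a submonoid coincide. -/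
theorem IsLeftHead.eq_of_isRightHead {G : GarsideStruct M} {P : Set M} {d e : M}
    (hd : IsLeftHead P G.Δ d) (he : IsRightHead P G.Δ e) : d = e :=
  G.eq_of_isFactor
    (he.2.2 d hd.1 ((G.delta_balanced d).1 hd.2.1)).isFactor
    (hd.2.2 e he.1 ((G.delta_balanced e).2 he.2.1)).isFactor

theorem LDvd.trans {a b c : M} (hab : LDvd a b) (hbc : LDvd b c) : LDvd a c := by
  obtain ⟨x, rfl⟩ := hab
  obtain ⟨y, rfl⟩ := hbc
  exact ⟨x * y, mul_assoc a x y⟩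

theorem RDvd.trans {a b c : M} (hab : RDvd a b) (hbc : RDvd b c) : RDvd a c := by
  obtain ⟨x, rfl⟩ := hab
  obtain ⟨y, rfl⟩ := hbc
  exact ⟨y * x, (mul_assoc y x a).symm⟩

/-- A factor-closed submonoid is generated by the divisors of the Garside element it contains. -/
theorem GarsideStruct.le_closure_of_factor_closed (G : GarsideStruct M) {P : Submonoid M}
    (hP : ∀ a b : M, b ∈ P → IsFactor a b → a ∈ P) :
    P ≤ Submonoid.closure {a : M | a ∈ P ∧ LDvd a G.Δ} := by
  intro p hp
  have hgen : p ∈ Submonoid.closure {a : M | LDvd a G.Δ} :=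
    G.delta_generates ▸ Submonoid.mem_top p
  induction hgen using Submonoid.closure_induction with
  | mem x hx => exact Submonoid.subset_closure ⟨hp, hx⟩
  | one => exact one_mem _
  | mul x y _ _ ihx ihy =>
    exact mul_mem (ihx (hP x _ hp (LDvd.isFactor ⟨y, rfl⟩)))
      (ihy (hP y _ hp (RDvd.isFactor ⟨x, rfl⟩)))

/-- `Δ_P = H_P(Δ)` is a Garside element of the standard
parabolic submonoid `P`: its left- and right-divisors coincide, they all lie
in `P`, they generate `P`, and `Δ_P` is also the right `P`-head of `Δ`. -/
theorem statement0 (G : GarsideStruct M) (P : Submonoid M)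
    (hP : IsStdParabolic P) (dP : M) (hdP : IsLeftHead (P : Set M) G.Δ dP) :
    (∀ a : M, LDvd a dP ↔ RDvd a dP) ∧
    (∀ a : M, LDvd a dP → a ∈ P) ∧
    Submonoid.closure {a : M | LDvd a dP} = P ∧
    IsRightHead (P : Set M) G.Δ dP := by
  obtain ⟨e, he⟩ := hP.exists_right_head G.Δ
  obtain rfl : dP = e := hdP.eq_of_isRightHead he
  have hl : ∀ a : M, LDvd a dP ↔ a ∈ P ∧ LDvd a G.Δ := fun a =>
    ⟨fun h => ⟨hP.factor_closed a dP hdP.1 h.isFactor, h.trans hdP.2.1⟩,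
      fun h => hdP.2.2 a h.1 h.2⟩
  have hr : ∀ a : M, RDvd a dP ↔ a ∈ P ∧ RDvd a G.Δ := fun a =>
    ⟨fun h => ⟨hP.factor_closed a dP hdP.1 h.isFactor, h.trans he.2.1⟩,
      fun h => he.2.2 a h.1 h.2⟩
  refine ⟨fun a => ?_, fun a ha => ((hl a).1 ha).1, le_antisymm ?_ ?_, he⟩
  · rw [hl, hr, G.delta_balanced]
  · exact Submonoid.closure_le.2 fun a ha => ((hl a).1 ha).1
  · simpa only [hl] using G.le_closure_of_factor_closed hP.factor_closed

end GarsidePaper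
end

section
/- Let P be a standard parabolic submonoid of M, let g be a P-ribbon, and let s be an atom of M which left-divides g (so in particular s ∉ P). Then v_{s,P} left-divides g. -/
/-!
Common setting: Garside monoids, standard parabolic submonoids, heads,
ribbons, following Digne–Michel, "Ribbons in Garside monoids".
-/

namespace GarsidePaper

variable {M : Type*}

variable [CancelMonoid M]

theorem isFactor_of_mul_mul (a b c : M) : IsFactor b (a * b * c) :=
  ⟨b * c, ⟨c, rfl⟩, ⟨a, mul_assoc a b c⟩⟩

theorem isFactor_mul_right (a b : M) : IsFactor a (a * b) := by
  simpa using isFactor_of_mul_mul 1 a b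

theorem isFactor_mul_left (a b : M) : IsFactor b (a * b) := by
  simpa using isFactor_of_mul_mul a b 1

/-- In a Garside monoid, the only factor of `1` is `1`. -/
theorem GarsideStruct.eq_one_of_isFactor_one (G : GarsideStruct M) {a : M}
    (h : IsFactor a 1) : a = 1 := by
  by_contra hne
  have h' : IsFactor (1 : M) a := by simpa using isFactor_mul_right 1 a
  exact G.noetherian.asymmetric a 1 ⟨h, hne⟩ ⟨h', Ne.symm hne⟩

/-- Every atom divides the Garside element. -/
theorem GarsideStruct.ldvd_delta_of_isAtom' (G : GarsideStruct M) {a : M} (ha : IsAtom' a) :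
    LDvd a G.Δ := by
  have hmem : a ∈ Submonoid.closure {a : M | LDvd a G.Δ} := by
    rw [G.delta_generates]
    trivial
  induction hmem using Submonoid.closure_induction with
  | mem x hx => exact hx
  | one => exact absurd rfl ha.1
  | mul x y _ _ hx hy =>
    rcases ha.2 x (isFactor_mul_right x y) with h | h
    · subst h
      rw [one_mul] at ha ⊢
      exact hy ha
    · rw [← h] at ha ⊢
      exact hx ha

/-- A factor-closed submonoid is contained in every submonoid containing its atoms. -/
theorem GarsideStruct.le_of_atoms_subset (G : GarsideStruct M) {P Q : Submonoid M}
    (hP : ∀ a b : M, b ∈ P → IsFactor a b → a ∈ P)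
    (hQ : ∀ a ∈ P, IsAtom' a → a ∈ Q) : P ≤ Q := by
  intro p
  induction p using G.noetherian.induction with
  | _ p ih =>
    intro hp
    by_cases h1 : p = 1
    · exact h1 ▸ Q.one_mem
    by_cases hat : IsAtom' p
    · exact hQ p hp hat
    obtain ⟨b, ⟨_, ⟨w, rfl⟩, ⟨u, hu⟩⟩, hb1, hbp⟩ :
        ∃ b, IsFactor b p ∧ b ≠ 1 ∧ b ≠ p := by
      simpa [IsAtom', h1] using hat
    have key : ∀ x, IsFactor x p → x ≠ p → x ∈ Q := fun x hx hne =>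
      ih x ⟨hx, hne⟩ (hP x p hp hx)
    have hbQ : b ∈ Q := key b ⟨_, ⟨w, rfl⟩, ⟨u, hu⟩⟩ hbp
    have huQ : u ∈ Q := by
      refine key u (hu ▸ isFactor_mul_right u _) fun h => hb1 ?_
      have hbw : b * w = 1 := mul_eq_left.mp (hu.symm.trans h.symm)
      exact G.eq_one_of_isFactor_one (hbw ▸ isFactor_mul_right b w)
    have hwQ : w ∈ Q := by
      refine key w (by rw [hu, ← mul_assoc]; exact isFactor_mul_left _ w) fun h => hb1 ?_
      rw [← mul_assoc] at hu
      have hub : u * b = 1 := mul_eq_right.mp (hu.symm.trans h.symm)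
      exact G.eq_one_of_isFactor_one (hub ▸ isFactor_mul_left u b)
    exact hu ▸ Q.mul_mem huQ (Q.mul_mem hbQ hwQ)

/-- if `g` is a `P`-ribbon and the atom `s` left-divides `g`
(so in particular `s ∉ P`), then `v_{s,P}` left-divides `g`. -/
theorem statement2 (G : GarsideStruct M) (hA : Assumption1 G)
    (P : Submonoid M) (hP : IsStdParabolic P)
    (g : M) (hg : IsRibbon (P : Set M) g)
    (s : M) (hs : IsAtom' s) (hsg : LDvd s g) (hsP : s ∉ P)
    (v : M) (hv : IsVsp G P s v) :
    LDvd v g := by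
  obtain ⟨Ps, ⟨hPs, hsub, hmin⟩, dP, dPs, hdP, hdPs, rfl⟩ := hv
  have hsmall : IsSmallestParabolicContaining ({a | a ∈ P ∧ IsAtom' a} ∪ {s}) Ps := by
    refine ⟨hPs, fun x hx => hsub (hx.imp And.left id), fun Q hQ hSQ => hmin Q hQ ?_⟩
    have hPQ : P ≤ Q :=
      G.le_of_atoms_subset hP.factor_closed fun a ha hat => hSQ (Or.inl ⟨ha, hat⟩)
    exact Set.union_subset hPQ fun x hx => hSQ (Or.inr hx)
  have hatoms : ∀ a ∈ {a | a ∈ P ∧ IsAtom' a} ∪ {s}, IsAtom' a := by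
    rintro a (ha | rfl)
    exacts [ha.2, hs]
  obtain ⟨c, hc⟩ := (hA _ hatoms Ps hsmall _ hdPs).2 (dP * g) (by
    rintro a (⟨haP, hat⟩ | rfl)
    · obtain ⟨e, he⟩ := hdP.2.2 a haP (G.ldvd_delta_of_isAtom' hat)
      exact ⟨e * g, by rw [he, mul_assoc]⟩
    · obtain ⟨e, he⟩ := hg.2 dP hdP.1
      obtain ⟨f, hf⟩ := hsg
      exact ⟨f * e, by rw [he, hf, mul_assoc]⟩)
  exact ⟨c, mul_left_cancel (hc.trans (mul_assoc dP v c))⟩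

end GarsidePaper
end

section
/- Let P be a standard parabolic submonoid of M, let s be an atom of M lying in P, and let g be a P-ribbon. Then the right-lcm of s and g equals s g. -/
/-!
Common setting: Garside monoids, standard parabolic submonoids, heads,
ribbons, following Digne–Michel, "Ribbons in Garside monoids".
-/

namespace GarsidePaper

variable {M : Type*}

variable [CancelMonoid M]

/-- if `s` is an atom of `P` and `g` is a `P`-ribbon (which
conjugates every atom of `P` to an atom, as holds under Assumption 1), then
the right-lcm of `s` and `g` is `s * g`. -/
theorem statement6 (G : GarsideStruct M)
    (P : Submonoid M) (hP : IsStdParabolic P)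
    (s : M) (hs : IsAtom' s) (hsP : s ∈ P)
    (g : M) (hg : IsRibbon (P : Set M) g)
    (hatoms : ∀ a ∈ P, IsAtom' a → ∀ c : M, a * g = g * c → IsAtom' c) :
    G.rlcm s g = s * g := by
  obtain ⟨c, hc⟩ := hg.2 s hsP
  have hcatom := hatoms s hsP hs c hc
  obtain ⟨d, hd⟩ := G.ldvd_rlcm_right s g
  obtain ⟨e, he⟩ := G.rlcm_least s g (s * g) ⟨g, rfl⟩ ⟨c, hc⟩
  have hcde : c = d * e := by
    rw [hc, hd, mul_assoc] at he
    exact mul_left_cancel he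
  rcases hcatom.2 d ⟨c, ⟨e, hcde⟩, 1, (one_mul c).symm⟩ with rfl | rfl
  · have hsg := G.ldvd_rlcm_left s g
    rw [hd, mul_one] at hsg
    exact absurd (hg.1 s hsP hsg) hs.1
  · rw [hd, hc]

end GarsidePaper
end

section
/- Let P be a standard parabolic submonoid of M satisfying Assumption 1, let g be a P-ribbon and let h ∈ M. Then T_P(g h) = g T_{P^g}(h) and H_P(g h)^g = H_{P^g}(h). In particular, if g is a P-ribbon and h is a P^g-ribbon, then g h is a P-ribbon. -/
/-!
Common setting: Garside monoids, standard parabolic submonoids, heads,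
ribbons, following Digne–Michel, "Ribbons in Garside monoids".
-/

namespace GarsidePaper

variable {M : Type*}

variable [CancelMonoid M]

lemma IsFactor.of_eq_mul {x a y b : M} (h : x = a * y * b) : IsFactor y x :=
  ⟨y * b, ⟨b, rfl⟩, ⟨a, by rw [h, mul_assoc]⟩⟩

namespace GarsideStruct

lemma eq_one_of_mul_eq_one (G : GarsideStruct M) {a b : M} (h : a * b = 1) : a = 1 := by
  by_contra ha
  have h1 : IsFactor a 1 := IsFactor.of_eq_mul (a := 1) (b := b) (by rw [one_mul, h])
  have h2 : IsFactor 1 a := IsFactor.of_eq_mul (a := a) (b := 1) (by simp)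
  exact G.noetherian.asymmetric (a := a) (b := 1) ⟨h1, ha⟩ ⟨h2, Ne.symm ha⟩

lemma exists_atom_ldvd (G : GarsideStruct M) {x : M} (hx : x ≠ 1) : ∃ s, IsAtom' s ∧ LDvd s x := by
  obtain ⟨s, ⟨hs1, hsx⟩, hmin⟩ :=
    G.noetherian.has_min {s : M | s ≠ 1 ∧ LDvd s x} ⟨x, hx, 1, (mul_one x).symm⟩
  refine ⟨s, ⟨hs1, fun b hb => ?_⟩, hsx⟩
  obtain ⟨e, hse⟩ := hsx
  obtain ⟨c, ⟨w, rfl⟩, ⟨u, hu⟩⟩ := hb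
  have key : ∀ y, y ≠ 1 → LDvd y s → y = s := by
    intro y hy hys
    by_contra hne
    obtain ⟨z, hz⟩ := hys
    refine hmin y ⟨hy, z * e, by rw [← mul_assoc, ← hz, hse]⟩
      ⟨IsFactor.of_eq_mul (a := 1) (b := z) (by rw [one_mul, hz]), hne⟩
  by_cases hu1 : u = 1
  · by_cases hb1 : b = 1
    · exact Or.inl hb1
    · exact Or.inr (key b hb1 ⟨w, by rw [hu, hu1, one_mul]⟩)
  · have hus := key u hu1 ⟨b * w, hu⟩
    rw [hus] at hu
    exact Or.inl (G.eq_one_of_mul_eq_one (left_eq_mul.mp hu))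

lemma atom_induction (G : GarsideStruct M) {C : M → Prop} (one : C 1)
    (mul : ∀ s x, IsAtom' s → C x → C (s * x)) (x : M) : C x := by
  induction x using G.noetherian.induction with
  | _ x ih =>
    by_cases hx : x = 1
    · rwa [hx]
    obtain ⟨s, hs, y, rfl⟩ := G.exists_atom_ldvd hx
    refine mul s y hs (ih y ⟨IsFactor.of_eq_mul (a := s) (b := 1) (by simp), fun h => ?_⟩)
    exact hs.1 (right_eq_mul.mp h)

lemma atom_ldvd_delta (G : GarsideStruct M) {s : M} (hs : IsAtom' s) : LDvd s G.Δ := by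
  have key : ∀ x ∈ Submonoid.closure {a : M | LDvd a G.Δ},
      x ≠ 1 → ∃ y, y ≠ 1 ∧ LDvd y G.Δ ∧ LDvd y x := by
    intro x hx
    induction hx using Submonoid.closure_induction with
    | mem x hx => exact fun h1 => ⟨x, h1, hx, 1, (mul_one x).symm⟩
    | one => exact fun h1 => absurd rfl h1
    | mul a b _ _ iha ihb =>
      intro h1
      by_cases ha : a = 1
      · subst ha
        rw [one_mul] at h1 ⊢
        exact ihb h1
      · obtain ⟨y, hy1, hyΔ, c, rfl⟩ := iha ha
        exact ⟨y, hy1, hyΔ, c * b, mul_assoc _ _ _⟩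
  obtain ⟨y, hy1, hyΔ, c, hc⟩ := key s (G.delta_generates ▸ Submonoid.mem_top s) hs.1
  rcases hs.2 y (IsFactor.of_eq_mul (a := 1) (b := c) (by rw [one_mul, hc])) with h | h
  · exact absurd h hy1
  · rwa [← h]

end GarsideStruct

namespace IsStdParabolic

variable {P : Submonoid M}

lemma mem_left (hP : IsStdParabolic P) {a b : M} (h : a * b ∈ P) : a ∈ P :=
  hP.factor_closed _ _ h (IsFactor.of_eq_mul (a := 1) (b := b) (by rw [one_mul]))

lemma mem_right (hP : IsStdParabolic P) {a b : M} (h : a * b ∈ P) : b ∈ P :=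
  hP.factor_closed _ _ h (IsFactor.of_eq_mul (a := a) (b := 1) (by rw [mul_one]))

lemma le_of_atoms_subset (G : GarsideStruct M) (hP : IsStdParabolic P) {Q : Submonoid M}
    (h : ∀ s ∈ P, IsAtom' s → s ∈ Q) : P ≤ Q := by
  intro x
  induction x using G.atom_induction with
  | one => exact fun _ => Q.one_mem
  | mul s x hs ih => exact fun hx => Q.mul_mem (h s (hP.mem_left hx) hs) (ih (hP.mem_right hx))

lemma sInf (G : GarsideStruct M) {F : Set (Submonoid M)} (hF : ∀ Q ∈ F, IsStdParabolic Q) :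
    IsStdParabolic (sInf F) := by
  refine ⟨fun a b hb hab => ?_, fun g => ?_, fun g => ?_⟩
  · rw [Submonoid.mem_sInf] at hb ⊢
    exact fun Q hQ => (hF Q hQ).factor_closed a b (hb Q hQ) hab
  · obtain ⟨y, ⟨x, hx, hxy⟩, hmin⟩ := G.noetherian.has_min
      {y : M | ∃ x ∈ InfSet.sInf F, g = x * y} ⟨g, 1, Submonoid.one_mem _, (one_mul g).symm⟩
    refine ⟨x, hx, ⟨y, hxy⟩, fun h' hh' hg' => ?_⟩
    obtain ⟨u, hu⟩ := G.ldvd_rlcm_left x h'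
    obtain ⟨y', hy'⟩ := G.rlcm_least x h' g ⟨y, hxy⟩ hg'
    have hyu : y = u * y' := mul_left_cancel (a := x) (by rw [← hxy, hy', hu, mul_assoc])
    have hmem : G.rlcm x h' ∈ InfSet.sInf F := by
      rw [Submonoid.mem_sInf] at hx hh' ⊢
      intro Q hQ
      obtain ⟨k, hk, -, hkmax⟩ := (hF Q hQ).exists_left_head g
      obtain ⟨z, hz⟩ := G.rlcm_least x h' k (hkmax x (hx Q hQ) ⟨y, hxy⟩)
        (hkmax h' (hh' Q hQ) hg')
      exact (hF Q hQ).mem_left (b := z) (hz ▸ hk)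
    have hyy : y' = y := by
      by_contra hne
      exact hmin y' ⟨_, hmem, hy'⟩
        ⟨IsFactor.of_eq_mul (a := u) (b := 1) (by rw [mul_one, hyu]), hne⟩
    rw [hyy] at hyu
    rw [right_eq_mul.mp hyu, mul_one] at hu
    exact hu ▸ G.ldvd_rlcm_right x h'
  · obtain ⟨y, ⟨x, hx, hxy⟩, hmin⟩ := G.noetherian.has_min
      {y : M | ∃ x ∈ InfSet.sInf F, g = y * x} ⟨g, 1, Submonoid.one_mem _, (mul_one g).symm⟩
    refine ⟨x, hx, ⟨y, hxy⟩, fun h' hh' hg' => ?_⟩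
    obtain ⟨u, hu⟩ := G.rdvd_llcm_left x h'
    obtain ⟨y', hy'⟩ := G.llcm_least x h' g ⟨y, hxy⟩ hg'
    have hyu : y = y' * u := mul_right_cancel (b := x) (by rw [← hxy, hy', hu, mul_assoc])
    have hmem : G.llcm x h' ∈ InfSet.sInf F := by
      rw [Submonoid.mem_sInf] at hx hh' ⊢
      intro Q hQ
      obtain ⟨k, hk, -, hkmax⟩ := (hF Q hQ).exists_right_head g
      obtain ⟨z, hz⟩ := G.llcm_least x h' k (hkmax x (hx Q hQ) ⟨y, hxy⟩)
        (hkmax h' (hh' Q hQ) hg')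
      exact (hF Q hQ).mem_right (a := z) (hz ▸ hk)
    have hyy : y' = y := by
      by_contra hne
      exact hmin y' ⟨_, hmem, hy'⟩
        ⟨IsFactor.of_eq_mul (a := 1) (b := u) (by rw [one_mul, hyu]), hne⟩
    rw [hyy] at hyu
    rw [left_eq_mul.mp hyu, one_mul] at hu
    exact hu ▸ G.rdvd_llcm_right x h'

lemma exists_smallest_containing (G : GarsideStruct M) (S : Set M) :
    ∃ P : Submonoid M, IsSmallestParabolicContaining S P := by
  refine ⟨InfSet.sInf {Q | IsStdParabolic Q ∧ S ⊆ Q}, sInf G fun Q hQ => hQ.1,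
    fun s hs => ?_, fun Q hQ hSQ => sInf_le ⟨hQ, hSQ⟩⟩
  exact Submonoid.mem_sInf.2 fun Q hQ => hQ.2 hs

variable {G : GarsideStruct M} {d : M}

/-- The left and right `P`-heads of `Δ` coincide. -/
lemma isRightHead_delta (hP : IsStdParabolic P) (hd : IsLeftHead (P : Set M) G.Δ d) :
    IsRightHead (P : Set M) G.Δ d := by
  obtain ⟨e, he, heΔ, hemax⟩ := hP.exists_right_head G.Δ
  obtain ⟨a, ha⟩ := hd.2.2 e he ((G.delta_balanced e).2 heΔ)
  obtain ⟨b, hb⟩ := hemax d hd.1 ((G.delta_balanced d).1 hd.2.1)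
  have h : e = b * e * a := by rw [mul_assoc, ← ha, ← hb]
  have hed : e = d := by
    by_contra hne
    exact G.noetherian.asymmetric (a := e) (b := d)
      ⟨IsFactor.of_eq_mul (a := 1) (b := a) (by rw [one_mul, ha]), hne⟩
      ⟨IsFactor.of_eq_mul (a := b) (b := 1) (by rw [mul_one, hb]), Ne.symm hne⟩
  exact hed ▸ ⟨he, heΔ, hemax⟩

lemma exists_mul_delta_eq (hP : IsStdParabolic P) (hd : IsLeftHead (P : Set M) G.Δ d) (x : M) :
    x ∈ P → ∃ y ∈ P, x * d = d * y := by
  induction x using G.atom_induction with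
  | one => exact fun _ => ⟨1, P.one_mem, by simp⟩
  | mul s x hs ih =>
    intro hsx
    obtain ⟨y, hy, hxy⟩ := ih (hP.mem_right hsx)
    obtain ⟨a, ha⟩ := hd.2.2 s (hP.mem_left hsx) (G.atom_ldvd_delta hs)
    have haP : a ∈ P := hP.mem_right (a := s) (ha ▸ hd.1)
    obtain ⟨c, hc⟩ := (hP.isRightHead_delta hd).2.1
    obtain ⟨b, hb⟩ := hd.2.2 a haP
      ((G.delta_balanced a).2 ⟨c * s, by rw [mul_assoc, ← ha, hc]⟩)
    refine ⟨b * y, P.mul_mem (hP.mem_right (a := a) (hb ▸ hd.1)) hy, ?_⟩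
    rw [mul_assoc, hxy, ← mul_assoc, ← mul_assoc]
    congr 1
    conv_lhs => rw [hb, ← mul_assoc, ← ha]

lemma exists_delta_mul_eq (hP : IsStdParabolic P) (hd : IsLeftHead (P : Set M) G.Δ d) (y : M) :
    y ∈ P → ∃ x ∈ P, x * d = d * y := by
  induction y using G.atom_induction with
  | one => exact fun _ => ⟨1, P.one_mem, by simp⟩
  | mul s y hs ih =>
    intro hsy
    obtain ⟨x, hx, hxy⟩ := ih (hP.mem_right hsy)
    obtain ⟨-, -, hrmax⟩ := hP.isRightHead_delta hd
    obtain ⟨a, ha⟩ := hrmax s (hP.mem_left hsy) ((G.delta_balanced s).1 (G.atom_ldvd_delta hs))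
    have haP : a ∈ P := hP.mem_left (b := s) (ha ▸ hd.1)
    obtain ⟨c, hc⟩ := hd.2.1
    obtain ⟨b, hb⟩ := hrmax a haP
      ((G.delta_balanced a).1 ⟨s * c, by rw [← mul_assoc, ← ha, hc]⟩)
    refine ⟨b * x, P.mul_mem (hP.mem_left (b := a) (hb ▸ hd.1)) hx, ?_⟩
    rw [mul_assoc, hxy, ← mul_assoc, ← mul_assoc]
    congr 1
    conv_rhs => rw [hb, mul_assoc, ← ha]

end IsStdParabolic

/-- The elements `y` such that `d * y = x * d` for some `x ∈ P`. -/
def conjSubmonoid (P : Submonoid M) (d : M) : Submonoid M where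
  carrier := conjSet (P : Set M) d
  one_mem' := ⟨1, P.one_mem, by simp⟩
  mul_mem' := by
    rintro a b ⟨x, hx, hxa⟩ ⟨y, hy, hyb⟩
    exact ⟨x * y, P.mul_mem hx hy, by rw [mul_assoc, hyb, ← mul_assoc, hxa, mul_assoc]⟩

lemma mem_conjSubmonoid {P : Submonoid M} {d y : M} :
    y ∈ conjSubmonoid P d ↔ ∃ x ∈ P, x * d = d * y := Iff.rfl

section Conj

variable {G : GarsideStruct M} {P : Submonoid M} {d a a' x x' : M}

lemma ldvd_iff_of_conj_delta (hP : IsStdParabolic P) (hd : IsLeftHead (P : Set M) G.Δ d)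
    (hx : x ∈ P) (hx' : x' ∈ P) (ha : a * d = d * a') (hxx : x * d = d * x') :
    LDvd a x ↔ LDvd a' x' := by
  constructor
  · rintro ⟨c, rfl⟩
    obtain ⟨c', -, hc⟩ := hP.exists_mul_delta_eq hd c (hP.mem_right hx)
    exact ⟨c', mul_left_cancel (a := d) (by
      rw [← hxx, mul_assoc, hc, ← mul_assoc, ha, mul_assoc])⟩
  · rintro ⟨c', rfl⟩
    obtain ⟨c, -, hc⟩ := hP.exists_delta_mul_eq hd c' (hP.mem_right hx')
    exact ⟨c, mul_right_cancel (b := d) (by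
      rw [hxx, mul_assoc, hc, ← mul_assoc, ← mul_assoc, ha])⟩

lemma rdvd_iff_of_conj_delta (hP : IsStdParabolic P) (hd : IsLeftHead (P : Set M) G.Δ d)
    (hx : x ∈ P) (hx' : x' ∈ P) (ha : a * d = d * a') (hxx : x * d = d * x') :
    RDvd a x ↔ RDvd a' x' := by
  constructor
  · rintro ⟨c, rfl⟩
    obtain ⟨c', -, hc⟩ := hP.exists_mul_delta_eq hd c (hP.mem_left hx)
    exact ⟨c', mul_left_cancel (a := d) (by
      rw [← hxx, mul_assoc, ha, ← mul_assoc, hc, mul_assoc])⟩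
  · rintro ⟨c', rfl⟩
    obtain ⟨c, -, hc⟩ := hP.exists_delta_mul_eq hd c' (hP.mem_left hx')
    exact ⟨c, mul_right_cancel (b := d) (by
      rw [hxx, mul_assoc, ha, ← mul_assoc, ← mul_assoc, hc])⟩

/-- Conjugation by the Garside element of a standard parabolic submonoid permutes the smaller
standard parabolic submonoids. -/
lemma IsStdParabolic.conj_delta {R : Submonoid M} (hR : IsStdParabolic R) (hRP : R ≤ P)
    (hP : IsStdParabolic P) (hd : IsLeftHead (P : Set M) G.Δ d) :
    IsStdParabolic (conjSubmonoid R d) := by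
  have hle : ∀ y ∈ conjSubmonoid R d, y ∈ P := by
    rintro y ⟨x, hx, hxy⟩
    obtain ⟨z, hz, hxz⟩ := hP.exists_mul_delta_eq hd x (hRP hx)
    rwa [← mul_left_cancel (a := d) (hxz.symm.trans hxy)]
  refine ⟨?_, fun g => ?_, fun g => ?_⟩
  · rintro a b hb ⟨c, hac, hcb⟩
    have hbP := hle b hb
    obtain ⟨y, hy, hyb⟩ := hb
    have hcP : c ∈ P := by obtain ⟨e, rfl⟩ := hcb; exact hP.mem_right hbP
    have haP : a ∈ P := by obtain ⟨e, rfl⟩ := hac; exact hP.mem_left hcP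
    obtain ⟨c₁, hc₁, hcc⟩ := hP.exists_delta_mul_eq hd c hcP
    obtain ⟨a₁, ha₁, haa⟩ := hP.exists_delta_mul_eq hd a haP
    refine ⟨a₁, hR.factor_closed a₁ y hy ⟨c₁, ?_, ?_⟩, haa⟩
    · exact (ldvd_iff_of_conj_delta hP hd hc₁ hcP haa hcc).2 hac
    · exact (rdvd_iff_of_conj_delta hP hd (hRP hy) hbP hcc hyb).2 hcb
  · obtain ⟨k, hk, ⟨e, hkg⟩, hkmax⟩ := hP.exists_left_head g
    obtain ⟨k₁, hk₁, hkk⟩ := hP.exists_delta_mul_eq hd k hk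
    obtain ⟨p, hp, hpk, hpmax⟩ := hR.exists_left_head k₁
    obtain ⟨q, hq, hpq⟩ := hP.exists_mul_delta_eq hd p (hRP hp)
    refine ⟨q, ⟨p, hp, hpq⟩, ?_, fun h hh hhg => ?_⟩
    · obtain ⟨c, hc⟩ := (ldvd_iff_of_conj_delta hP hd hk₁ hk hpq hkk).1 hpk
      exact ⟨c * e, by rw [hkg, hc, mul_assoc]⟩
    · have hhk := hkmax h (hle h hh) hhg
      obtain ⟨r, hr, hrh⟩ := hh
      exact (ldvd_iff_of_conj_delta hP hd (hRP hp) hq hrh hpq).1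
        (hpmax r hr ((ldvd_iff_of_conj_delta hP hd hk₁ hk hrh hkk).2 hhk))
  · obtain ⟨k, hk, ⟨e, hkg⟩, hkmax⟩ := hP.exists_right_head g
    obtain ⟨k₁, hk₁, hkk⟩ := hP.exists_delta_mul_eq hd k hk
    obtain ⟨p, hp, hpk, hpmax⟩ := hR.exists_right_head k₁
    obtain ⟨q, hq, hpq⟩ := hP.exists_mul_delta_eq hd p (hRP hp)
    refine ⟨q, ⟨p, hp, hpq⟩, ?_, fun h hh hhg => ?_⟩
    · obtain ⟨c, hc⟩ := (rdvd_iff_of_conj_delta hP hd hk₁ hk hpq hkk).1 hpk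
      exact ⟨e * c, by rw [hkg, hc, mul_assoc]⟩
    · have hhk := hkmax h (hle h hh) hhg
      obtain ⟨r, hr, hrh⟩ := hh
      exact (rdvd_iff_of_conj_delta hP hd (hRP hp) hq hrh hpq).1
        (hpmax r hr ((rdvd_iff_of_conj_delta hP hd hk₁ hk hrh hkk).2 hhk))

end Conj

/-- Every nontrivial `P`-ribbon `g` is left-divisible by a nontrivial `P`-ribbon conjugating `P`
to a standard parabolic submonoid. -/
lemma IsRibbon.exists_ldvd {G : GarsideStruct M} (hA : Assumption1 G) {P : Submonoid M}
    (hP : IsStdParabolic P) {g : M} (hg : IsRibbon (P : Set M) g) (hg1 : g ≠ 1) :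
    ∃ v, v ≠ 1 ∧ LDvd v g ∧ ConjSetDef (P : Set M) v ∧ IsStdParabolic (conjSubmonoid P v) := by
  obtain ⟨s, hs, hsg⟩ := G.exists_atom_ldvd hg1
  let S : Set M := {a | IsAtom' a ∧ (a ∈ P ∨ a = s)}
  obtain ⟨R, hR⟩ := IsStdParabolic.exists_smallest_containing G S
  obtain ⟨d, hd⟩ : ∃ d, IsLeftHead (P : Set M) G.Δ d := hP.exists_left_head G.Δ
  obtain ⟨e, he⟩ : ∃ e, IsLeftHead (R : Set M) G.Δ e := hR.1.exists_left_head G.Δ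
  obtain ⟨hSe, hemin⟩ := hA S (fun a ha => ha.1) R hR e he
  have hPR : P ≤ R := hP.le_of_atoms_subset G fun a ha haa => hR.2.1 ⟨haa, Or.inl ha⟩
  obtain ⟨v, rfl⟩ := he.2.2 d (hPR hd.1) hd.2.1
  have hvg : LDvd v g := by
    obtain ⟨c, hc⟩ := hemin (d * g) fun a ha => by
      rcases ha.2 with haP | rfl
      · obtain ⟨b, hb⟩ := hd.2.2 a haP (G.atom_ldvd_delta ha.1)
        exact ⟨b * g, by rw [hb, mul_assoc]⟩
      · obtain ⟨b, hb⟩ := hsg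
        obtain ⟨f, hf⟩ := hg.2 d hd.1
        exact ⟨b * f, by rw [hf, ← mul_assoc, ← hb]⟩
    exact ⟨c, mul_left_cancel (a := d) (by rw [hc, mul_assoc])⟩
  have hconj : ∀ {p p' q : M}, p' * d = d * p → (p * v = v * q ↔ p' * (d * v) = d * v * q) := by
    intro p p' q hp
    rw [← mul_assoc, hp, mul_assoc, mul_assoc, mul_right_inj]
  have heq : conjSubmonoid P v = conjSubmonoid P (d * v) := by
    ext q
    constructor
    · rintro ⟨p, hp, hpq⟩
      obtain ⟨p', hp', hpp⟩ := hP.exists_delta_mul_eq hd p hp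
      exact ⟨p', hp', (hconj hpp).1 hpq⟩
    · rintro ⟨p', hp', hpq⟩
      obtain ⟨p, hp, hpp⟩ := hP.exists_mul_delta_eq hd p' hp'
      exact ⟨p, hp, (hconj hpp).2 hpq⟩
  refine ⟨v, ?_, hvg, fun p hp => ?_, heq ▸ hP.conj_delta hPR hR.1 he⟩
  · rintro rfl
    obtain ⟨b, hb⟩ := hSe s ⟨hs, Or.inr rfl⟩
    rw [mul_one] at hb
    exact hs.1 (hg.1 s (hP.mem_left (b := b) (hb ▸ hd.1)) hsg)
  · obtain ⟨p', hp', hpp⟩ := hP.exists_delta_mul_eq hd p hp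
    obtain ⟨q, -, hq⟩ := hR.1.exists_mul_delta_eq he p' (hPR hp')
    exact ⟨q, (hconj hpp).2 hq⟩

/-- If `v` is a `P`-ribbon with `P ^ v` standard parabolic, then `p * v` is the right-lcm of
`p ∈ P` and `v`. -/
lemma IsRibbon.ldvd_mul_of_isStdParabolic (G : GarsideStruct M) {P : Submonoid M}
    {v : M} (hv : IsRibbon (P : Set M) v) (hQ : IsStdParabolic (conjSubmonoid P v))
    {p m : M} (hp : p ∈ P) (hpm : LDvd p m) (hvm : LDvd v m) : LDvd (p * v) m := by
  obtain ⟨c, hc⟩ := hv.2 p hp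
  obtain ⟨q, hq⟩ := G.ldvd_rlcm_right p v
  obtain ⟨r, hr⟩ := G.ldvd_rlcm_left p v
  obtain ⟨z, hz⟩ := G.rlcm_least p v (p * v) ⟨v, rfl⟩ ⟨c, hc⟩
  have hcq : c = q * z := mul_left_cancel (a := v) (by rw [← hc, hz, hq, mul_assoc])
  have hcQ : c ∈ conjSubmonoid P v := ⟨p, hp, hc⟩
  obtain ⟨p₁, hp₁, hpq⟩ := hQ.mem_left (hcq ▸ hcQ)
  obtain ⟨p₂, hp₂, hpz⟩ := hQ.mem_right (hcq ▸ hcQ)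
  have hpp : p = p₁ * p₂ := mul_right_cancel (b := v) (by
    rw [hc, hcq, ← mul_assoc, ← hpq, mul_assoc, ← hpz, mul_assoc])
  have hp₂v : p₂ * r = v := mul_left_cancel (a := p₁) (by
    rw [← mul_assoc, ← hpp, ← hr, hq, hpq])
  have hp₂1 : p₂ = 1 := hv.1 p₂ hp₂ ⟨r, hp₂v.symm⟩
  rw [hp₂1, one_mul] at hp₂v
  rw [← hp₂v, ← hr]
  exact G.rlcm_least p v m hpm hvm

/-- If `g` is a `P`-ribbon, then `p * g` is the right-lcm of `p ∈ P` and `g`. -/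
lemma IsRibbon.ldvd_mul_of_ldvd {G : GarsideStruct M} (hA : Assumption1 G) {P : Submonoid M}
    (hP : IsStdParabolic P) {g : M} (hg : IsRibbon (P : Set M) g) {p : M} (hp : p ∈ P) (m : M)
    (hpm : LDvd p m) (hgm : LDvd g m) : LDvd (p * g) m := by
  induction g using G.noetherian.induction generalizing P p m with
  | _ g ih =>
    by_cases hg1 : g = 1
    · rwa [hg1, mul_one]
    obtain ⟨v, hv1, ⟨g', rfl⟩, hvdef, hQ⟩ := hg.exists_ldvd hA hP hg1
    have hv : IsRibbon (P : Set M) v :=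
      ⟨fun q hq ⟨c, hc⟩ => hg.1 q hq ⟨c * g', by rw [hc, mul_assoc]⟩, hvdef⟩
    have hg' : IsRibbon (conjSubmonoid P v : Set M) g' := by
      constructor
      · rintro x ⟨q, hq, hqx⟩ ⟨c, hc⟩
        have hq1 : q = 1 := hg.1 q hq ⟨v * c, by rw [hc, ← mul_assoc, ← hqx, mul_assoc]⟩
        rw [hq1, one_mul] at hqx
        exact left_eq_mul.mp hqx
      · rintro x ⟨q, hq, hqx⟩
        obtain ⟨c, hc⟩ := hg.2 q hq
        exact ⟨c, mul_left_cancel (a := v) (by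
          rw [← mul_assoc, ← hqx, mul_assoc, hc, mul_assoc])⟩
    obtain ⟨c, hc⟩ := hv.2 p hp
    obtain ⟨y, rfl⟩ : LDvd v m := by
      obtain ⟨y, rfl⟩ := hgm
      exact ⟨g' * y, mul_assoc _ _ _⟩
    obtain ⟨w, hw⟩ := hv.ldvd_mul_of_isStdParabolic G hQ hp hpm ⟨y, rfl⟩
    obtain ⟨z, hz⟩ := hgm
    obtain ⟨k, hk⟩ := ih g'
      ⟨IsFactor.of_eq_mul (a := v) (b := 1) (by rw [mul_one]), fun h => hv1 (right_eq_mul.mp h)⟩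
      hQ hg' (p := c) ⟨p, hp, hc⟩ y
      ⟨w, mul_left_cancel (a := v) (by rw [hw, hc, mul_assoc])⟩
      ⟨z, mul_left_cancel (a := v) (by rw [hz, mul_assoc])⟩
    exact ⟨k, by rw [hk, ← mul_assoc, ← mul_assoc, ← mul_assoc, hc]⟩

/-- if `g` is a `P`-ribbon and `h ∈ M`, then
`T_P(g h) = g * T_{P^g}(h)` and `H_P(g h) ^ g = H_{P^g}(h)`; in particular,
if moreover `h` is a `P^g`-ribbon then `g * h` is a `P`-ribbon. -/
theorem statement8 (G : GarsideStruct M) (hA : Assumption1 G)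
    (P : Submonoid M) (hP : IsStdParabolic P)
    (g : M) (hg : IsRibbon (P : Set M) g) (h : M)
    (hd t : M) (hhd : IsLeftHead (P : Set M) (g * h) hd) (ht : g * h = hd * t)
    (hd' t' : M) (hhd' : IsLeftHead (conjSet (P : Set M) g) h hd')
    (ht' : h = hd' * t') :
    t = g * t' ∧ hd * g = g * hd' ∧
      (IsRibbon (conjSet (P : Set M) g) h → IsRibbon (P : Set M) (g * h)) := by
  have hlcm := fun p hp => hg.ldvd_mul_of_ldvd hA hP (p := p) hp
  obtain ⟨hhdP, -, hhdmax⟩ := hhd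
  obtain ⟨⟨p, hp, hpg⟩, -, hhdmax'⟩ := hhd'
  obtain ⟨k, hk⟩ := hg.2 hd hhdP
  have hkh : LDvd k h := by
    obtain ⟨c, hc⟩ := hlcm hd hhdP (g * h) ⟨t, ht⟩ ⟨h, rfl⟩
    exact ⟨c, mul_left_cancel (a := g) (by rw [hc, hk, mul_assoc])⟩
  obtain ⟨y, hy⟩ := hhdmax' k ⟨hd, hhdP, hk⟩ hkh
  obtain ⟨x, hx⟩ := hhdmax p hp ⟨g * t', by rw [ht', ← mul_assoc, ← mul_assoc, hpg]⟩
  obtain ⟨x', hx'⟩ := hg.2 x (hP.mem_right (by rwa [← hx]))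
  have hkx : k = hd' * x' := mul_left_cancel (a := g) (by
    rw [← hk, hx, mul_assoc, hx', ← mul_assoc, hpg, mul_assoc])
  have hxy : x' * y = 1 := mul_left_cancel (a := hd') (by
    rw [← mul_assoc, ← hkx, ← hy, mul_one])
  have hconj : hd * g = g * hd' := by
    rw [hk, hkx, G.eq_one_of_mul_eq_one hxy, mul_one]
  refine ⟨mul_left_cancel (a := hd) ?_, hconj, fun hr => ⟨?_, ?_⟩⟩
  · rw [← ht, ht', ← mul_assoc, ← mul_assoc, hconj]
  · intro q hq hqgh
    obtain ⟨q', hq'⟩ := hg.2 q hq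
    obtain ⟨c, hc⟩ := hlcm q hq (g * h) hqgh ⟨h, rfl⟩
    have h1 := hr.1 q' ⟨q, hq, hq'⟩
      ⟨c, mul_left_cancel (a := g) (by rw [hc, hq', mul_assoc])⟩
    exact mul_right_cancel (b := g) (by rw [hq', h1, one_mul, mul_one])
  · intro q hq
    obtain ⟨q', hq'⟩ := hg.2 q hq
    obtain ⟨c, hc⟩ := hr.2 q' ⟨q, hq, hq'⟩
    exact ⟨c, by rw [← mul_assoc, hq', mul_assoc, hc, mul_assoc]⟩

end GarsidePaper
end
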